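/- Every total domishold finite simple graph admits a total domishold structure (w,t) in which w(x) > 0 for every vertex x. -/

import Mathlib

/-- A total dominating set: every vertex of the graph has a neighbor in `D`. -/
def TotalDomSet {V : Type*} (G : SimpleGraph V) (D : Finset V) : Prop :=
  ∀ v : V, ∃ u ∈ D, G.Adj v u

/-- `(w,t)` is a total domishold structure of `G`. -/
def IsTDStructure {V : Type*} [Fintype V] (G : SimpleGraph V) (w : V → NNReal) (t : NNReal) :
    Prop :=
  ∀ S : Finset V, t ≤ ∑ x ∈ S, w x ↔ TotalDomSet G S

/-- A graph is total domishold if it admits a total domishold structure. -/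
def TotalDomishold {V : Type*} [Fintype V] (G : SimpleGraph V) : Prop :=
  ∃ (w : V → NNReal) (t : NNReal), IsTDStructure G w t

open Filter Topology in
/-- All weights can be raised by a common positive amount so that every light set stays light. -/
theorem exists_pos_forall_sum_add_lt {V : Type*} [Fintype V] (w : V → NNReal) (t : NNReal) :
    ∃ ε : NNReal, 0 < ε ∧ ∀ S : Finset V, ∑ x ∈ S, w x < t → ∑ x ∈ S, (w x + ε) < t := by
  have h : ∀ᶠ ε in 𝓝[>] (0 : NNReal),
      ∀ S : Finset V, ∑ x ∈ S, w x < t → ∑ x ∈ S, (w x + ε) < t := by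
    refine eventually_all.2 fun S ↦ ?_
    by_cases hS : ∑ x ∈ S, w x < t
    · have hc : Continuous fun ε : NNReal ↦ ∑ x ∈ S, (w x + ε) := by fun_prop
      filter_upwards [nhdsWithin_le_nhds (hc.continuousAt.eventually_lt_const
        (by simpa using hS))] with ε hε _ using hε
    · exact Eventually.of_forall fun _ h ↦ absurd h hS
  obtain ⟨ε, hε, hpos⟩ := (h.and self_mem_nhdsWithin).exists
  exact ⟨ε, hpos, hε⟩

/-- Every total domishold graph admits a total domishold structure with all weights positive. -/
theorem stmt_1 {V : Type*} [Fintype V] (G : SimpleGraph V) (h : TotalDomishold G) :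
    ∃ (w : V → NNReal) (t : NNReal), IsTDStructure G w t ∧ ∀ x : V, 0 < w x := by
  obtain ⟨w, t, hw⟩ := h
  obtain ⟨ε, hε, hlt⟩ := exists_pos_forall_sum_add_lt w t
  refine ⟨fun x ↦ w x + ε, t, fun S ↦ ?_, fun x ↦ add_pos_of_nonneg_of_pos zero_le hε⟩
  rw [← hw S]
  refine ⟨fun h ↦ not_lt.1 fun hS ↦ (hlt S hS).not_ge h, fun h ↦ h.trans ?_⟩
  exact Finset.sum_le_sum fun x _ ↦ le_add_of_nonneg_right hε.le
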